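/- There exists a universal constant c > 0 such that for all n ≥ 1, all ε with 1/n ≤ ε ≤ 1/2, and every subset A ⊆ L_mid with |A| = σ·2^n (σ > 0): Pr_{(x,y) ← D′}[x ∈ A and y ∈ A] ≥ c·σ²·ε⁴/ln(1/ε). -/

import Mathlib

open Finset

/-- The Hamming weight `‖x‖₁` of `x ∈ {0,1}^n`. -/
def wt {n : ℕ} (x : Fin n → Bool) : ℕ :=
  (Finset.univ.filter (fun i => x i = true)).card

/-- The Hamming distance `‖x − y‖₁`. -/
def hamm {n : ℕ} (x y : Fin n → Bool) : ℕ :=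
  (Finset.univ.filter (fun i => x i ≠ y i)).card

/-- The parameter `d = d(n,ε) = 2⌈√(2n·ln(100/ε))⌉`. -/
noncomputable def dPar (n : ℕ) (ε : ℝ) : ℕ :=
  2 * ⌈Real.sqrt (2 * n * Real.log (100 / ε))⌉₊

open Classical in
/-- The middle layers `L_mid = {x : (n−d)/2 ≤ ‖x‖₁ ≤ (n+d)/2}`. -/
noncomputable def Lmid (n : ℕ) (ε : ℝ) : Finset (Fin n → Bool) :=
  Finset.univ.filter (fun x =>
    ((n : ℝ) - dPar n ε) / 2 ≤ (wt x : ℝ) ∧ (wt x : ℝ) ≤ ((n : ℝ) + dPar n ε) / 2)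

/-- The `j`-th point (from the bottom) of the path from `0^n` to `1^n` determined by the
permutation `π`: its ones are exactly in positions `π(0),…,π(j−1)`. -/
def pathPoint {n : ℕ} (π : Equiv.Perm (Fin n)) (j : ℕ) : Fin n → Bool :=
  fun i => decide ((π.symm i : ℕ) < j)

/-- The indices `j` of the points of the path `π` lying in the middle layers `L_mid`. -/
noncomputable def pmidIdx (n : ℕ) (ε : ℝ) (π : Equiv.Perm (Fin n)) : Finset ℕ :=
  (Finset.range (n + 1)).filter (fun j => pathPoint π j ∈ Lmid n ε)

/-- The paths from `0^n` to `1^n` passing through `x` (paths are parametrized by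
permutations; the path of `π` passes through `x` iff its point at level `‖x‖₁` is `x`). -/
noncomputable def pathsThrough (n : ℕ) (x : Fin n → Bool) : Finset (Equiv.Perm (Fin n)) :=
  Finset.univ.filter (fun π => pathPoint π (wt x) = x)

/-- `Pr_{(x,y) ← D′}[y ∈ A ∣ x = x*]`: given `x*`, pick a path `π` uniformly among all
paths through `0^n`, `x*` and `1^n`, then pick `y` uniformly from the points of `π`
lying in `L_mid`. -/
noncomputable def prYinA (n : ℕ) (ε : ℝ) (x : Fin n → Bool) (A : Finset (Fin n → Bool)) : ℝ :=
  (∑ π ∈ pathsThrough n x,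
      (((pmidIdx n ε π).filter (fun j => pathPoint π j ∈ A)).card : ℝ) /
        ((pmidIdx n ε π).card : ℝ)) /
    ((pathsThrough n x).card : ℝ)

/-- `Pr_{(x,y) ← D′}[x ∈ A ∧ y ∈ A]`: pick `x` uniformly from `L_mid`, then a uniform
path through `0^n`, `x`, `1^n`, then `y` uniform among the points of the path in `L_mid`. -/
noncomputable def prBothD' (n : ℕ) (ε : ℝ) (A : Finset (Fin n → Bool)) : ℝ :=
  (∑ x ∈ Lmid n ε, (if x ∈ A then prYinA n ε x A else 0)) / ((Lmid n ε).card : ℝ)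

lemma aux_choose_even (m : ℕ) : (2 * m + 1) * (Nat.centralBinom m) ^ 2 ≤ 16 ^ m := by
  induction m with
  | zero => simp
  | succ m ih =>
    have h := Nat.succ_mul_centralBinom_succ m
    have hpos : 0 < (m + 1) ^ 2 := by positivity
    refine Nat.le_of_mul_le_mul_left ?_ hpos
    have e : (m + 1) ^ 2 * ((2 * (m + 1) + 1) * (Nat.centralBinom (m + 1)) ^ 2)
        = (2 * m + 3) * ((m + 1) * Nat.centralBinom (m + 1)) ^ 2 := by ring
    rw [e, h]
    have e2 : (2 * m + 3) * (2 * (2 * m + 1) * m.centralBinom) ^ 2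
        = 4 * ((2 * m + 3) * (2 * m + 1)) * ((2 * m + 1) * m.centralBinom ^ 2) := by ring
    rw [e2]
    have e3 : (m + 1) ^ 2 * 16 ^ (m + 1) = 4 * (4 * (m + 1) ^ 2) * 16 ^ m := by ring
    rw [e3]
    have : (2 * m + 3) * (2 * m + 1) ≤ 4 * (m + 1) ^ 2 := by nlinarith
    gcongr

lemma aux_choose (n : ℕ) : (n + 1) * (n.choose (n / 2)) ^ 2 ≤ 4 ^ n := by
  rcases Nat.even_or_odd' n with ⟨m, rfl | rfl⟩
  · have h := aux_choose_even m
    rw [Nat.centralBinom] at h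
    have : 2 * m / 2 = m := by omega
    rw [this, pow_mul]
    exact h
  · have h := aux_choose_even (m + 1)
    have e : Nat.centralBinom (m + 1) = 2 * (2 * m + 1).choose m := by
      rw [Nat.centralBinom, show 2 * (m + 1) = (2 * m + 1) + 1 by ring, Nat.choose_succ_succ,
        ← Nat.choose_symm_half m]
      ring
    have : (2 * m + 1) / 2 = m := by omega
    rw [this]
    rw [e] at h
    have e3 : 4 ^ (2 * m + 1) = 4 * 16 ^ m := by rw [pow_succ, pow_mul]; norm_num; ring
    rw [e3]
    rw [pow_succ 16] at h
    nlinarith [sq_nonneg ((2 * m + 1).choose m)]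

lemma aux_wt_pathPoint {n : ℕ} (π : Equiv.Perm (Fin n)) (j : ℕ) (hj : j ≤ n) :
    wt (pathPoint π j) = j := by
  unfold wt pathPoint
  have : (Finset.univ.filter (fun i : Fin n => decide ((π.symm i : ℕ) < j) = true)).card
      = (Finset.univ.filter (fun i : Fin n => (i : ℕ) < j)).card := by
    refine Finset.card_equiv π.symm ?_
    intro i
    simp
  rw [this, Fin.card_filter_val_lt]
  omega

lemma aux_wt_le {n : ℕ} (x : Fin n → Bool) : wt x ≤ n := by
  unfold wt
  exact (Finset.card_le_univ _).trans (by simp)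

lemma aux_exists_perm {n : ℕ} (x y : Fin n → Bool) (h : wt x = wt y) :
    ∃ τ : Equiv.Perm (Fin n), ∀ i, y (τ i) = x i := by
  have hc : Fintype.card {i // x i = true} = Fintype.card {i // y i = true} := by
    rw [Fintype.card_subtype, Fintype.card_subtype]; exact h
  obtain ⟨e⟩ := Fintype.card_eq.mp hc
  refine ⟨e.extendSubtype, fun i => ?_⟩
  by_cases hi : x i = true
  · rw [hi]; exact e.extendSubtype_mem i hi
  · have := e.extendSubtype_not_mem i hi
    simp only [Bool.not_eq_true] at this hi
    rw [hi, this]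

lemma aux_card_le {n : ℕ} (x y : Fin n → Bool) (h : wt x = wt y) :
    (pathsThrough n x).card ≤ (pathsThrough n y).card := by
  obtain ⟨τ, hτ⟩ := aux_exists_perm x y h
  refine Finset.card_le_card_of_injOn (fun π => π.trans τ) ?_ ?_
  · intro π hπ
    simp only [pathsThrough, Finset.coe_filter, Finset.mem_univ, true_and, Set.mem_setOf_eq] at hπ ⊢
    funext i
    have h1 := congrFun hπ (τ.symm i)
    rw [← hτ, Equiv.apply_symm_apply, h] at h1
    rw [← h1]
    rfl
  · intro a _ b _ hab
    ext i
    have := congrArg (fun e : Equiv.Perm (Fin n) => e i) hab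
    simp at this
    rw [this]

lemma aux_layer (n k : ℕ) :
    (Finset.univ.filter (fun x : Fin n → Bool => wt x = k)).card = n.choose k := by
  have : (Finset.univ.filter (fun x : Fin n → Bool => wt x = k)).card
      = (Finset.powersetCard k (Finset.univ : Finset (Fin n))).card := by
    refine Finset.card_bij' (fun x _ => Finset.univ.filter (fun i => x i = true))
      (fun s _ => fun i => decide (i ∈ s)) ?_ ?_ ?_ ?_
    · intro x hx
      simp only [Finset.mem_filter, Finset.mem_univ, true_and] at hx
      simp only [Finset.mem_powersetCard, Finset.subset_univ, true_and]
      exact hx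
    · intro s hs
      simp only [Finset.mem_powersetCard, Finset.subset_univ, true_and] at hs
      rw [Finset.mem_filter]
      refine ⟨Finset.mem_univ _, ?_⟩
      simp [wt, hs]
    · intro x _
      funext i
      simp
    · intro s _
      ext i
      simp
  rw [this]; simp

lemma aux_paths {n : ℕ} (x : Fin n → Bool) :
    n.factorial ≤ (pathsThrough n x).card * n.choose (n / 2) := by
  have h1 : (Finset.univ : Finset (Equiv.Perm (Fin n))).card
      ≤ (pathsThrough n x).card *
        (Finset.univ.filter (fun y : Fin n → Bool => wt y = wt x)).card := by
    refine Finset.card_le_mul_card_image_of_maps_to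
      (f := fun π => pathPoint π (wt x)) ?_ _ ?_
    · intro π _
      simp only [Finset.mem_filter, Finset.mem_univ, true_and]
      exact aux_wt_pathPoint π _ (aux_wt_le x)
    · intro y hy
      simp only [Finset.mem_filter, Finset.mem_univ, true_and] at hy
      refine le_trans ?_ (aux_card_le y x hy)
      unfold pathsThrough
      rw [hy]
  rw [aux_layer, Finset.card_univ, Fintype.card_perm, Fintype.card_fin] at h1
  exact h1.trans (Nat.mul_le_mul_left _ (Nat.choose_le_middle _ _))

lemma aux_M (n : ℕ) (ε : ℝ) (π : Equiv.Perm (Fin n)) : (pmidIdx n ε π).card ≤ dPar n ε + 1 := by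
  obtain ⟨k, hk⟩ : ∃ k, dPar n ε = 2 * k := ⟨_, rfl⟩
  have : pmidIdx n ε π ⊆ Finset.Icc ((n + 1) / 2 - k) (n / 2 + k) := by
    intro j hj
    simp only [pmidIdx, Lmid, Finset.mem_filter, Finset.mem_range, Finset.mem_univ, true_and] at hj
    obtain ⟨hj, h1, h2⟩ := hj
    rw [aux_wt_pathPoint π j (by omega), hk] at h1 h2
    have h1' : n ≤ 2 * j + 2 * k := by
      have : (n : ℝ) ≤ 2 * j + 2 * k := by push_cast at h1; linarith
      exact_mod_cast this
    have h2' : 2 * j ≤ n + 2 * k := by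
      have : (2 : ℝ) * j ≤ n + 2 * k := by push_cast at h2; linarith
      exact_mod_cast this
    rw [Finset.mem_Icc]
    omega
  refine (Finset.card_le_card this).trans ?_
  rw [Nat.card_Icc, hk]
  omega

lemma aux_d (n : ℕ) (hn : 1 ≤ n) (ε : ℝ) (h0 : 0 < ε) (h2 : ε ≤ 1 / 2) :
    (dPar n ε : ℝ) + 1 ≤ 22 * Real.sqrt n * Real.log (1 / ε) := by
  set t := Real.log (1 / ε) with ht
  have hn' : (1 : ℝ) ≤ n := by exact_mod_cast hn
  have hlt : Real.log 2 ≤ t := by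
    apply Real.log_le_log (by norm_num)
    rw [le_div_iff₀ h0]; linarith
  have hl2 := Real.log_two_gt_d9
  have htpos : 0 < t := by linarith
  have h100 : Real.log 100 ≤ 7 * Real.log 2 := by
    have : (7 : ℝ) * Real.log 2 = Real.log (2 ^ 7) := by rw [Real.log_pow]; norm_num
    rw [this]
    exact Real.log_le_log (by norm_num) (by norm_num)
  have he : Real.log (100 / ε) ≤ 8 * t := by
    rw [show (100 : ℝ) / ε = 100 * (1 / ε) by ring, Real.log_mul (by norm_num) (by positivity)]
    linarith
  have hs1 : 1 ≤ Real.sqrt n := Real.one_le_sqrt.mpr hn'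
  have hsq : Real.sqrt n ^ 2 = n := Real.sq_sqrt (by positivity)
  have hs : Real.sqrt (2 * n * Real.log (100 / ε)) ≤ 8 * Real.sqrt n * t := by
    apply Real.sqrt_le_iff.mpr
    refine ⟨by positivity, ?_⟩
    rw [mul_pow, mul_pow, hsq]
    have : (2 : ℝ) * n * Real.log (100 / ε) ≤ 2 * n * (8 * t) := by gcongr
    have h3 : 0 ≤ (n : ℝ) * (t * (t - 1 / 4)) := by
      apply mul_nonneg (by positivity)
      apply mul_nonneg <;> linarith
    nlinarith
  have hc := (Nat.ceil_lt_add_one (Real.sqrt_nonneg (2 * n * Real.log (100 / ε)))).le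
  unfold dPar
  push_cast
  have : 1 * (1 / 2) ≤ Real.sqrt n * t := by
    apply mul_le_mul hs1 (by linarith) (by norm_num) (by positivity)
  nlinarith

lemma aux_main (n : ℕ) (ε : ℝ) (A : Finset (Fin n → Bool)) (hA : A ⊆ Lmid n ε)
    (hne : A.Nonempty) :
    (A.card : ℝ) ^ 2 / (n.choose (n / 2) * (dPar n ε + 1) * 2 ^ n) ≤ prBothD' n ε A := by
  set N : Equiv.Perm (Fin n) → ℝ := fun π =>
    (((pmidIdx n ε π).filter (fun j => pathPoint π j ∈ A)).card : ℝ) with hN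
  set P : (Fin n → Bool) → ℝ := fun x => ((pathsThrough n x).card : ℝ) with hP
  set D : ℝ := (dPar n ε : ℝ) + 1 with hD
  set C : ℝ := (n.choose (n / 2) : ℝ) with hC
  set W : Equiv.Perm (Fin n) → ℝ := fun π =>
    ∑ x ∈ A, if π ∈ pathsThrough n x then 1 / P x else 0 with hW
  have hDpos : 0 < D := by positivity
  have hCpos : 0 < C := by
    have : 0 < n.choose (n / 2) := Nat.choose_pos (Nat.div_le_self _ _)
    rw [hC]; exact_mod_cast this
  have hfac : (0 : ℝ) < n.factorial := by exact_mod_cast n.factorial_pos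
  have hPC : ∀ x, (n.factorial : ℝ) ≤ P x * C := fun x => by
    simp only [hP, hC]; exact_mod_cast aux_paths x
  have hPpos : ∀ x, 0 < P x := fun x =>
    pos_of_mul_pos_left (lt_of_lt_of_le hfac (hPC x)) hCpos.le
  have hN0 : ∀ π, 0 ≤ N π := fun π => by simp [hN]
  have hW0 : ∀ π, 0 ≤ W π := fun π => by
    apply Finset.sum_nonneg
    intro x _
    split_ifs
    · exact (one_div_pos.mpr (hPpos x)).le
    · exact le_rfl
  have hY : ∀ x, (∑ π ∈ pathsThrough n x, N π) / (D * P x) ≤ prYinA n ε x A := by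
    intro x
    unfold prYinA
    rw [← div_div, Finset.sum_div]
    apply div_le_div_of_nonneg_right _ (hPpos x).le
    apply Finset.sum_le_sum
    intro π _
    rcases Nat.eq_zero_or_pos (pmidIdx n ε π).card with h | h
    · have : N π = 0 := by
        simp only [hN]
        rw [Finset.card_eq_zero] at h
        rw [h]; simp
      rw [this]; simp
      positivity
    · apply div_le_div_of_nonneg_left (hN0 π)
      · exact_mod_cast h
      · rw [hD]; exact_mod_cast aux_M n ε π
  have hsum : ∑ π, N π * W π / D ≤ ∑ x ∈ A, prYinA n ε x A := by
    have : ∑ π, N π * W π / D = ∑ x ∈ A, (∑ π ∈ pathsThrough n x, N π) / (D * P x) := by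
      simp only [hW, Finset.mul_sum, Finset.sum_div]
      rw [Finset.sum_comm]
      apply Finset.sum_congr rfl
      intro x _
      rw [← Finset.sum_filter_add_sum_filter_not Finset.univ (fun π => π ∈ pathsThrough n x)]
      rw [Finset.sum_eq_zero (s := Finset.univ.filter (fun π => ¬ π ∈ pathsThrough n x)), add_zero,
        Finset.filter_univ_mem]
      · apply Finset.sum_congr rfl
        intro π hπ
        rw [if_pos hπ]
        field_simp
      · intro π hπ
        rw [if_neg (Finset.mem_filter.mp hπ).2]
        simp
    rw [this]
    exact Finset.sum_le_sum fun x _ => hY x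
  have hWN : ∀ π, W π ≤ N π * (C / n.factorial) := by
    intro π
    have h1 : W π ≤ ∑ x ∈ A, if π ∈ pathsThrough n x then C / n.factorial else 0 := by
      apply Finset.sum_le_sum
      intro x _
      split_ifs
      · rw [div_le_div_iff₀ (hPpos x) hfac]
        linarith [hPC x]
      · exact le_rfl
    refine h1.trans ?_
    rw [← Finset.sum_filter, Finset.sum_const, nsmul_eq_mul]
    apply mul_le_mul_of_nonneg_right _ (by positivity)
    simp only [hN]
    rw [Nat.cast_le]
    refine Finset.card_le_card_of_injOn wt ?_ ?_
    · intro x hx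
      simp only [Finset.coe_filter, Set.mem_setOf_eq, pathsThrough, Finset.mem_filter,
        Finset.mem_univ, true_and] at hx
      simp only [Finset.coe_filter, Set.mem_setOf_eq, pmidIdx, Finset.mem_filter,
        Finset.mem_range, hx.2]
      exact ⟨⟨Nat.lt_succ_of_le (aux_wt_le x), hA hx.1⟩, hx.1⟩
    · intro x hx y hy hxy
      simp only [Finset.coe_filter, Set.mem_setOf_eq, pathsThrough, Finset.mem_filter,
        Finset.mem_univ, true_and] at hx hy
      rw [← hx.2, ← hy.2, hxy]
  have hWsum : ∑ π, W π = A.card := by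
    simp only [hW]
    rw [Finset.sum_comm]
    have : ∀ x ∈ A, (∑ π, if π ∈ pathsThrough n x then 1 / P x else 0) = 1 := by
      intro x _
      rw [← Finset.sum_filter, Finset.filter_univ_mem, Finset.sum_const, nsmul_eq_mul]
      exact mul_one_div_cancel (hPpos x).ne'
    rw [Finset.sum_congr rfl this]
    simp
  have hCS : (A.card : ℝ) ^ 2 ≤ n.factorial * ∑ π, W π ^ 2 := by
    have := sq_sum_le_card_mul_sum_sq (s := (Finset.univ : Finset (Equiv.Perm (Fin n)))) (f := W)
    rw [hWsum, Finset.card_univ, Fintype.card_perm, Fintype.card_fin] at this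
    exact this
  have hNW : (A.card : ℝ) ^ 2 / (C * D) ≤ ∑ π, N π * W π / D := by
    have h1 : ∑ π, W π ^ 2 ≤ (∑ π, N π * W π) * (C / n.factorial) := by
      rw [Finset.sum_mul]
      apply Finset.sum_le_sum
      intro π _
      nlinarith [mul_le_mul_of_nonneg_right (hWN π) (hW0 π)]
    have h2 : (A.card : ℝ) ^ 2 ≤ (∑ π, N π * W π) * C := by
      refine hCS.trans ((mul_le_mul_of_nonneg_left h1 hfac.le).trans_eq ?_)
      field_simp
    rw [← Finset.sum_div, ← div_div]
    apply div_le_div_of_nonneg_right _ hDpos.le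
    rw [div_le_iff₀ hCpos]
    exact h2
  have hLpos : (0 : ℝ) < ((Lmid n ε).card : ℝ) := by
    exact_mod_cast Finset.card_pos.mpr (hne.mono hA)
  have hLle : ((Lmid n ε).card : ℝ) ≤ 2 ^ n := by
    have : (Lmid n ε).card ≤ 2 ^ n := (Finset.card_le_univ _).trans (by simp)
    exact_mod_cast this
  unfold prBothD'
  have hS : (∑ x ∈ Lmid n ε, (if x ∈ A then prYinA n ε x A else 0)) = ∑ x ∈ A, prYinA n ε x A := by
    rw [← Finset.sum_filter, Finset.filter_mem_eq_inter, Finset.inter_eq_right.mpr hA]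
  rw [hS, ← div_div]
  exact div_le_div₀ ((by positivity : (0:ℝ) ≤ (A.card : ℝ) ^ 2 / (C * D)).trans (hNW.trans hsum))
    (hNW.trans hsum) hLpos hLle

open Classical in
theorem prob_both_in_A_under_D' :
    ∃ c : ℝ, 0 < c ∧ ∀ n : ℕ, 1 ≤ n → ∀ ε : ℝ, 1 / (n : ℝ) ≤ ε → ε ≤ 1 / 2 →
      ∀ A : Finset (Fin n → Bool), A ⊆ Lmid n ε → ∀ σ : ℝ, 0 < σ →
        (A.card : ℝ) = σ * 2 ^ n →
        c * σ ^ 2 * ε ^ 4 / Real.log (1 / ε) ≤ prBothD' n ε A := by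
  refine ⟨1 / 22, by norm_num, ?_⟩
  intro n hn ε h1 h2 A hA σ hσ hcard
  have hn' : (0 : ℝ) < n := by exact_mod_cast hn
  have h0 : 0 < ε := lt_of_lt_of_le (by positivity) h1
  have hne : A.Nonempty := by
    rw [← Finset.card_pos]
    have : (0 : ℝ) < A.card := by rw [hcard]; positivity
    exact_mod_cast this
  refine le_trans ?_ (aux_main n ε A hA hne)
  have hd := aux_d n hn ε h0 h2
  set t := Real.log (1 / ε)
  have ht : 0 < t := by
    apply Real.log_pos
    rw [lt_div_iff₀ h0]; linarith
  have hCpos : (0 : ℝ) < n.choose (n / 2) := by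
    exact_mod_cast Nat.choose_pos (Nat.div_le_self _ _)
  have hC : (n.choose (n / 2) : ℝ) * Real.sqrt n ≤ 2 ^ n := by
    refine (abs_le_of_sq_le_sq' ?_ (by positivity)).2
    rw [mul_pow, Real.sq_sqrt hn'.le]
    have h := aux_choose n
    have h' : ((n : ℝ) + 1) * (n.choose (n / 2) : ℝ) ^ 2 ≤ 4 ^ n := by exact_mod_cast h
    have e : ((2 : ℝ) ^ n) ^ 2 = 4 ^ n := by rw [← pow_mul, mul_comm, pow_mul]; norm_num
    rw [e]
    nlinarith [sq_nonneg (n.choose (n / 2) : ℝ)]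
  have hε : ε ^ 4 ≤ 1 := pow_le_one₀ h0.le (by linarith)
  have hCD : (n.choose (n / 2) : ℝ) * (dPar n ε + 1) ≤ 22 * t * 2 ^ n := by
    calc (n.choose (n / 2) : ℝ) * (dPar n ε + 1)
        ≤ n.choose (n / 2) * (22 * Real.sqrt n * t) := by gcongr
      _ = 22 * t * (n.choose (n / 2) * Real.sqrt n) := by ring
      _ ≤ _ := by gcongr
  calc 1 / 22 * σ ^ 2 * ε ^ 4 / t ≤ 1 / 22 * σ ^ 2 * 1 / t := by gcongr
    _ = (σ * 2 ^ n) ^ 2 / (22 * t * 2 ^ n * 2 ^ n) := by field_simp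
    _ ≤ _ := by
      rw [hcard]
      gcongr
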